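/- If T(s) is the Jacobi flow along a unit-speed geodesic, invertible on 0 < s ≤ s₁, and the curvature satisfies δ(s) ≤ ⟨R(u,c'(s))c'(s),u⟩ for unit u, then ‖T(s)‖ f_δ(t) ≥ ‖T(t)‖ f_δ(s) for 0 ≤ s ≤ t ≤ s₁, and ‖T(s)u‖ ≤ f_δ(s)‖u‖ for 0 ≤ s ≤ s₁. -/

import Mathlib

open scoped RealInnerProductSpace

section jfaux
open Set Filter Topology

lemma jf_mono1 (φ : ℝ → ℝ) (a b : ℝ) (hab : a ≤ b)
    (hr : ∀ p ∈ Ico a b, ∀ ε > 0, ∀ᶠ s in 𝓝[>] p, φ s ≤ φ p + ε * (s - p))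
    (hl : ∀ p ∈ Ioc a b, ∀ ε > 0, ∀ᶠ s in 𝓝[<] p, φ p ≤ φ s + ε) : φ b ≤ φ a := by
  have key : ∀ ε > 0, φ b ≤ φ a + ε * (b - a) := by
    intro ε hε
    set S : Set ℝ := {r | r ∈ Icc a b ∧ φ r ≤ φ a + ε * (r - a)} with hS
    have haS : a ∈ S := ⟨⟨le_rfl, hab⟩, by simp⟩
    have hbdd : BddAbove S := ⟨b, fun r hr => hr.1.2⟩
    have hlub : IsLUB S (sSup S) := isLUB_csSup ⟨a, haS⟩ hbdd
    set r := sSup S with hrdef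
    have har : a ≤ r := hlub.1 haS
    have hrb : r ≤ b := hlub.2 (fun x hx => hx.1.2)
    have hrS : r ∈ S := by
      refine ⟨⟨har, hrb⟩, ?_⟩
      by_contra hcon
      push Not at hcon
      have har' : a < r := by
        rcases har.lt_or_eq with h | h
        · exact h
        · rw [← h] at hcon; simp at hcon
      set η := φ r - (φ a + ε * (r - a)) with hη
      have hη0 : 0 < η := by linarith
      have h1 := hl r ⟨har', hrb⟩ (η / 2) (by linarith)
      obtain ⟨c, hc, hcs⟩ := (mem_nhdsLT_iff_exists_Ioo_subset' har').1 h1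
      obtain ⟨x, hxS, hcx, hxr⟩ := hlub.exists_between hc
      rcases hxr.lt_or_eq with h | h
      · have := hcs ⟨hcx, h⟩
        simp only [mem_ofPred_eq] at this
        have h3 := hxS.2
        nlinarith
      · rw [h] at hxS; linarith [hxS.2]
    rcases hrb.lt_or_eq with h | h
    · have h1 := hr r ⟨har, h⟩ ε hε
      obtain ⟨c, hc, hcs⟩ := (mem_nhdsGT_iff_exists_Ioo_subset' h).1 h1
      have hc' : r < c := hc
      obtain ⟨x, hx1, hx2⟩ := exists_between (lt_min hc' h)
      have := hcs ⟨hx1, lt_of_lt_of_le hx2 (min_le_left _ _)⟩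
      simp only [mem_ofPred_eq] at this
      have hxS : x ∈ S := ⟨⟨by linarith, (lt_of_lt_of_le hx2 (min_le_right _ _)).le⟩, by
        have := hrS.2; linarith⟩
      linarith [hlub.1 hxS]
    · have := hrS.2
      rw [h] at this
      exact this
  by_contra hcon
  push Not at hcon
  have h1 := key ((φ b - φ a) / (2 * (b - a + 1))) (by apply div_pos <;> linarith)
  have h2 : (φ b - φ a) / (2 * (b - a + 1)) * (b - a) ≤ (φ b - φ a) / 2 := by
    rw [div_mul_eq_mul_div, div_le_div_iff₀ (by linarith) (by norm_num)]
    nlinarith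
  linarith

def JfD (h : ℝ → ℝ) (p c : ℝ) : Prop :=
  ∀ ε > 0, ∀ᶠ s in 𝓝 p, (h s - h p) * (s - p) ≤ (c + ε) * (s - p) ^ 2

lemma JfD.right {h : ℝ → ℝ} {p c : ℝ} (H : JfD h p c) {ε : ℝ} (hε : 0 < ε) :
    ∀ᶠ s in 𝓝[>] p, h s - h p ≤ (c + ε) * (s - p) := by
  filter_upwards [nhdsWithin_le_nhds (H ε hε), self_mem_nhdsWithin] with s hs hsp
  have : 0 < s - p := sub_pos.2 hsp
  nlinarith

lemma JfD.left {h : ℝ → ℝ} {p c : ℝ} (H : JfD h p c) {ε : ℝ} (hε : 0 < ε) :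
    ∀ᶠ s in 𝓝[<] p, h p - h s ≤ (c + ε) * (p - s) := by
  filter_upwards [nhdsWithin_le_nhds (H ε hε), self_mem_nhdsWithin] with s hs hsp
  have : 0 < p - s := sub_pos.2 hsp
  nlinarith

lemma jf_antiD (h Q : ℝ → ℝ) (a b κ : ℝ) (hab : a ≤ b)
    (hD : ∀ p ∈ Icc a b, JfD h p (-Q p)) (hκ : ∀ p ∈ Icc a b, κ ≤ Q p) :
    h b + κ * b ≤ h a + κ * a := by
  apply jf_mono1 (fun s => h s + κ * s) a b hab
  · intro p hp ε hε
    have hp' : p ∈ Icc a b := ⟨hp.1, hp.2.le⟩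
    filter_upwards [(hD p hp').right hε, self_mem_nhdsWithin] with s hs hsp
    have : 0 < s - p := sub_pos.2 hsp
    have := hκ p hp'
    nlinarith
  · intro p hp ε hε
    have hp' : p ∈ Icc a b := ⟨hp.1.le, hp.2⟩
    have hnear : ∀ᶠ s in 𝓝[<] p, p - s < ε := by
      apply nhdsWithin_le_nhds
      have : ContinuousAt (fun s => p - s) p := by fun_prop
      exact this.eventually_lt_const (by simpa using hε)
    filter_upwards [(hD p hp').left one_pos, self_mem_nhdsWithin, hnear] with s hs hsp hn
    have h0 : 0 < p - s := sub_pos.2 hsp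
    have := hκ p hp'
    nlinarith

set_option maxHeartbeats 1000000 in
lemma jf_endR (h Z : ℝ → ℝ) (α b κ M : ℝ) (hab : α < b) 
    (hZ : ∀ x, 0 ≤ Z x)
    (hD : ∀ p ∈ Ioc α b, JfD h p (-(Z p) ^ 2)) (hκ : ∀ p ∈ Ioc α b, κ ≤ (Z p) ^ 2)
    (hA : ∀ᶠ s in 𝓝 α, |h s - h α| ≤ M * |s - α| * (1 + Z s)) :
    h b + κ * b ≤ h α + κ * α := by
  have hanti : ∀ x y, α < x → x ≤ y → y ≤ b → h y ≤ h x := by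
    intro x y hx hxy hy
    have := jf_antiD h (fun p => Z p ^ 2) x y 0 hxy (fun p hp => hD p ⟨by linarith [hp.1], by linarith [hp.2]⟩)
      (fun p hp => sq_nonneg _)
    simpa using this
  obtain ⟨M, hM, hA⟩ : ∃ M > 0, ∀ᶠ s in 𝓝 α, |h s - h α| ≤ M * |s - α| * (1 + Z s) := by
    refine ⟨|M| + 1, by positivity, ?_⟩
    filter_upwards [hA] with s hs
    refine hs.trans ?_
    have := hZ s
    gcongr
    linarith [le_abs_self M]
  have step1 : ∀ x ∈ Ioc α b, h x ≤ h α := by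
    intro x2 hx2
    by_contra hcon
    push Not at hcon
    set η := h x2 - h α with hη
    have hη0 : 0 < η := by linarith
    have hA' := (mem_nhdsGT_iff_exists_Ioo_subset' hx2.1).1 (nhdsWithin_le_nhds hA)
    obtain ⟨c, hc, hcs⟩ := hA'
    have hc' : α < c := hc
    have hlt : α < min (min c x2) (α + η / (2 * M)) := by
      refine lt_min (lt_min hc' hx2.1) ?_
      have : 0 < η / (2 * M) := by positivity
      linarith
    obtain ⟨x1, hx1, hx1'⟩ := exists_between hlt
    have hx1c : x1 < c := lt_of_lt_of_le hx1' ((min_le_left _ _).trans (min_le_left _ _))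
    have hx12 : x1 < x2 := lt_of_lt_of_le hx1' ((min_le_left _ _).trans (min_le_right _ _))
    have hx1M : x1 - α < η / (2 * M) := by
      have := lt_of_lt_of_le hx1' (min_le_right _ _); linarith
    have hx1M' : M * (x1 - α) < η / 2 := by
      rw [lt_div_iff₀ (by positivity)] at hx1M
      linarith
    set g : ℝ → ℝ := fun x => h x - h α with hg
    have hgη : ∀ x, α < x → x ≤ x1 → η ≤ g x := by
      intro x h1 h2
      have := hanti x x2 h1 (by linarith) hx2.2
      simp only [hg, hη]; linarith
    set k : ℝ := 1 / (4 * M ^ 2) with hk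
    have hk0 : 0 < k := by positivity
    have hZg : ∀ x, α < x → x ≤ x1 → k * (g x) ^ 2 / (x - α) ^ 2 ≤ Z x ^ 2 := by
      intro x h1 h2
      have h3 := hcs ⟨h1, by linarith⟩
      simp only [mem_ofPred_eq] at h3
      have h4 := hgη x h1 h2
      have hx0 : 0 < x - α := by linarith
      rw [abs_of_pos hx0] at h3
      have h5 := (le_abs_self _).trans h3
      have h6 : g x ≤ 2 * M * (x - α) * Z x := by
        have : M * (x - α) ≤ M * (x1 - α) := by gcongr
        simp only [hg] at h4 ⊢
        nlinarith
      rw [div_le_iff₀ (by positivity), hk, div_mul_eq_mul_div, div_le_iff₀ (by positivity)]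
      have : (g x) ^ 2 ≤ (2 * M * (x - α) * Z x) ^ 2 := by
        apply pow_le_pow_left₀ (by linarith) h6
      nlinarith
    have hφ : ∀ x, α < x → x ≤ x1 →
        -1 / g x1 - k / (x1 - α) ≤ -1 / g x - k / (x - α) := by
      intro x hx hxx
      apply jf_mono1 (fun x => -1 / g x - k / (x - α)) x x1 hxx
      · intro p hp ε hε
        have hpα : 0 < p - α := by linarith [hp.1]
        have hgp : 0 < g p := lt_of_lt_of_le hη0 (hgη p (by linarith) hp.2.le)
        have hZp := hZg p (by linarith) hp.2.le
        have hZpos : 0 < Z p ^ 2 := lt_of_lt_of_le (by positivity) hZp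
        have hp' : p ∈ Ioc α b := ⟨by linarith, by linarith [hp.2, hx2.2]⟩
        have hε' : 0 < min (Z p ^ 2) (ε * g p ^ 2) := lt_min hZpos (by positivity)
        have hlt : ∀ᶠ s in 𝓝[>] p, s < x1 := nhdsWithin_le_nhds (eventually_lt_nhds hp.2)
        filter_upwards [(hD p hp').right hε', self_mem_nhdsWithin, hlt] with s hs hsp hs1
        have hsp' : 0 < s - p := sub_pos.2 hsp
        have hsα : 0 < s - α := by linarith
        have hgs : 0 < g s := lt_of_lt_of_le hη0 (hgη s (by linarith) hs1.le)
        have hgsp : g s ≤ g p := by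
          have := hanti p s hp'.1 (by linarith) (by linarith [hx2.2])
          simp only [hg]; linarith
        set ε' := min (Z p ^ 2) (ε * g p ^ 2) with hε'd
        have e1 : ε' ≤ Z p ^ 2 := min_le_left _ _
        have e2 : ε' ≤ ε * g p ^ 2 := min_le_right _ _
        have hs' : g s - g p ≤ (-Z p ^ 2 + ε') * (s - p) := by
          simp only [hg]; linarith
        have i1 : -1 / g s - -1 / g p ≤ (-Z p ^ 2 + ε') * (s - p) / g p ^ 2 := by
          have : -1 / g s - -1 / g p = (g s - g p) / (g s * g p) := by field_simp; ring
          rw [this, div_le_div_iff₀ (by positivity) (by positivity)]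
          have hneg : (-Z p ^ 2 + ε') * (s - p) ≤ 0 := by nlinarith
          have a1 : (g s - g p) * g p ^ 2 ≤ (-Z p ^ 2 + ε') * (s - p) * g p ^ 2 := by gcongr
          have a2 : g s * g p ≤ g p ^ 2 := by
            rw [sq]; exact mul_le_mul_of_nonneg_right hgsp hgp.le
          exact a1.trans (mul_le_mul_of_nonpos_left a2 hneg)
        have i2 : k / (p - α) - k / (s - α) ≤ k * (s - p) / (p - α) ^ 2 := by
          have : k / (p - α) - k / (s - α) = k * (s - p) / ((p - α) * (s - α)) := by
            field_simp; ring
          rw [this]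
          gcongr
          nlinarith
        have i3 : (-Z p ^ 2 + ε') * (s - p) / g p ^ 2 + k * (s - p) / (p - α) ^ 2 ≤ ε * (s - p) := by
          have b1 : k / (p - α) ^ 2 ≤ Z p ^ 2 / g p ^ 2 := by
            rw [le_div_iff₀ (by positivity)]
            calc _ = k * g p ^ 2 / (p - α) ^ 2 := by ring
              _ ≤ _ := hZp
          have b2 : ε' / g p ^ 2 ≤ ε := by
            rw [div_le_iff₀ (by positivity)]; exact e2
          have : (-Z p ^ 2 + ε') * (s - p) / g p ^ 2 + k * (s - p) / (p - α) ^ 2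
            = (s - p) * (k / (p - α) ^ 2 - Z p ^ 2 / g p ^ 2 + ε' / g p ^ 2) := by ring
          rw [this]
          nlinarith
        linarith
      · intro p hp ε hε
        have hpα : 0 < p - α := by linarith [hp.1]
        have hc1 : ContinuousAt (fun s => k / (s - α)) p := by
          apply ContinuousAt.div <;> first | fun_prop | exact hpα.ne'
        have hc2 := hc1.eventually_lt_const (u := k / (p - α) + ε) (by linarith)
        have hlt : ∀ᶠ s in 𝓝[<] p, x < s := nhdsWithin_le_nhds (eventually_gt_nhds hp.1)
        filter_upwards [nhdsWithin_le_nhds hc2, self_mem_nhdsWithin, hlt] with s hs hsp hsx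
        have hsp' : s < p := hsp
        have hgp : 0 < g p := lt_of_lt_of_le hη0 (hgη p (by linarith) hp.2)
        have hgsp : g p ≤ g s := by
          have := hanti s p (by linarith) hsp'.le (by linarith [hx2.2, hp.2])
          simp only [hg]; linarith
        have : 1 / g s ≤ 1 / g p := one_div_le_one_div_of_le hgp hgsp
        have e1 : -1 / g s = - (1 / g s) := by ring
        have e2 : -1 / g p = - (1 / g p) := by ring
        rw [e1, e2]
        linarith
    set C := 1 / g x1 + k / (x1 - α) with hC
    have hg1 : 0 < g x1 := lt_of_lt_of_le hη0 (hgη x1 hx1 le_rfl)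
    have hx1α : 0 < x1 - α := by linarith
    have hC0 : 0 < C := by positivity
    set e := min (x1 - α) (k / (2 * C)) with he
    have he0 : 0 < e := lt_min hx1α (by positivity)
    have := hφ (α + e) (by linarith) (by linarith [min_le_left (x1 - α) (k / (2 * C))])
    have hge : 0 < g (α + e) := lt_of_lt_of_le hη0 (hgη _ (by linarith) (by linarith [min_le_left (x1 - α) (k / (2 * C))]))
    have h2 : 2 * C ≤ k / e := by
      rw [le_div_iff₀ he0]
      have := min_le_right (x1 - α) (k / (2 * C))
      rw [← he, le_div_iff₀ (by positivity)] at this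
      linarith
    have e1 : -1 / g x1 = - (1 / g x1) := by ring
    have e2 : -1 / g (α + e) = - (1 / g (α + e)) := by ring
    rw [e1, e2, add_sub_cancel_left] at this
    have : 0 < 1 / g (α + e) := by positivity
    linarith
  have hlim : Tendsto (fun x => h α + κ * x) (𝓝[>] α) (𝓝 (h α + κ * α)) := by
    apply tendsto_nhdsWithin_of_tendsto_nhds
    have : ContinuousAt (fun x => h α + κ * x) α := by fun_prop
    exact this
  apply ge_of_tendsto hlim
  filter_upwards [Ioc_mem_nhdsGT hab] with x hx
  have h1 := jf_antiD h (fun p => Z p ^ 2) x b κ hx.2 (fun p hp => hD p ⟨by linarith [hp.1, hx.1], hp.2⟩)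
      (fun p hp => hκ p ⟨by linarith [hp.1, hx.1], hp.2⟩)
  linarith [step1 x hx]

lemma jf_endL (h Z : ℝ → ℝ) (β a κ M : ℝ) (hab : a < β) 
    (hZ : ∀ x, 0 ≤ Z x)
    (hD : ∀ p ∈ Ico a β, JfD h p (-(Z p) ^ 2)) (hκ : ∀ p ∈ Ico a β, κ ≤ (Z p) ^ 2)
    (hA : ∀ᶠ s in 𝓝 β, |h s - h β| ≤ M * |s - β| * (1 + Z s)) :
    h β + κ * β ≤ h a + κ * a := by
  have hneg : ∀ x : ℝ, Tendsto (fun s : ℝ => -s) (𝓝 (-x)) (𝓝 x) := by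
    intro x
    have : ContinuousAt (fun s : ℝ => -s) (-x) := by fun_prop
    simpa [ContinuousAt] using this
  have := jf_endR (fun s => - h (-s)) (fun s => Z (-s)) (-β) (-a) κ M (by linarith)
    (fun x => hZ _) ?_ ?_ ?_
  · simp only [neg_neg] at this
    linarith
  · intro p hp ε hε
    have h1 := hD (-p) ⟨by linarith [hp.2], by linarith [hp.1]⟩ ε hε
    have h2 := hneg (-p)
    rw [neg_neg] at h2
    filter_upwards [h2.eventually h1] with s hs
    convert hs using 1 <;> ring
  · intro p hp
    exact hκ (-p) ⟨by linarith [hp.2], by linarith [hp.1]⟩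
  · filter_upwards [(hneg β).eventually hA] with s hs
    simp only [neg_neg]
    rw [show -h (-s) - -h β = -(h (-s) - h β) by ring, abs_neg,
      show s - -β = -(-s - β) by ring, abs_neg]
    exact hs

lemma jf_scalar (h Z : ℝ → ℝ) (l r : ℝ) (hZ : ∀ x, 0 ≤ Z x)
    (hA : ∀ p ∈ Ioo l r, ∃ M, ∀ᶠ s in 𝓝 p, |h s - h p| ≤ M * |s - p| * (1 + Z s))
    (hB : ∀ p ∈ Ioo l r, ∀ y < Z p ^ 2, ∀ᶠ s in 𝓝 p, y < Z s ^ 2)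
    (hC : ∀ p ∈ Ioo l r, ∀ n : ℝ, ∀ ε > 0, ∀ᶠ s in 𝓝 p, Z s ^ 2 ≤ n →
      (h s - h p) * (s - p) ≤ (-(Z p) ^ 2 + ε) * (s - p) ^ 2) :
    AntitoneOn h (Ioo l r) := by
  set D : Set ℝ := {p | JfD h p (-(Z p) ^ 2)} with hDdef
  have main : Ioo l r ⊆ D := by
    intro p0 hp0
    by_contra hp0D
    set P : Set ℝ := Ioo l r ∩ (interior D)ᶜ with hP
    have hp0P : p0 ∈ P := ⟨hp0, fun hh => hp0D (interior_subset hh)⟩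
    have hPlc : IsLocallyClosed P :=
      isOpen_Ioo.isLocallyClosed.inter isOpen_interior.isClosed_compl.isLocallyClosed
    have : LocallyCompactSpace P := hPlc.locallyCompactSpace
    have : Nonempty P := ⟨⟨p0, hp0P⟩⟩
    have hclosed : ∀ n : ℕ, IsClosed {x : P | Z x ^ 2 ≤ n} := by
      intro n
      rw [← isOpen_compl_iff, isOpen_iff_mem_nhds]
      intro x hx
      simp only [mem_compl_iff, mem_ofPred_eq, not_le] at hx
      have h1 := hB x x.2.1 n hx
      have h2 : Tendsto (Subtype.val : P → ℝ) (𝓝 x) (𝓝 x.1) := continuous_subtype_val.continuousAt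
      filter_upwards [h2.eventually h1] with s hs
      simpa using hs
    obtain ⟨n, x, hx⟩ := nonempty_interior_of_iUnion_of_closed hclosed (by
      ext x
      simp only [mem_iUnion, mem_ofPred_eq, mem_univ, iff_true]
      exact exists_nat_ge _)
    rw [mem_interior_iff_mem_nhds, mem_nhds_subtype] at hx
    obtain ⟨J0, hJ0, hJsub⟩ := hx
    have hJ1 : J0 ∩ Ioo l r ∈ 𝓝 x.1 := inter_mem hJ0 (isOpen_Ioo.mem_nhds x.2.1)
    obtain ⟨ρ, hρ, hball⟩ := Metric.mem_nhds_iff.1 hJ1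
    have hJn : ∀ y ∈ Metric.ball x.1 ρ, y ∈ P → Z y ^ 2 ≤ n := by
      intro y hy hyP
      exact hJsub (show (⟨y, hyP⟩ : P) ∈ Subtype.val ⁻¹' J0 from (hball hy).1)
    have hJD : Metric.ball x.1 ρ ⊆ D := by
      intro p hp
      by_cases hpP : p ∈ P
      swap
      · have : p ∈ interior D := by
          by_contra hcon
          exact hpP ⟨(hball hp).2, hcon⟩
        exact interior_subset this
      have hpI := (hball hp).2
      intro ε hε
      set κ := Z p ^ 2 - ε with hκ
      have e1 := hB p hpI κ (by linarith)
      have e2 := hC p hpI n ε hε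
      have e3 : Metric.ball x.1 ρ ∈ 𝓝 p := Metric.isOpen_ball.mem_nhds hp
      obtain ⟨η, hη, hηs⟩ := Metric.eventually_nhds_iff_ball.1 ((e1.and e2).and e3)
      have hInt : ∀ s ∈ Metric.ball p η, s ∈ Ioo l r := fun s hs => (hball (hηs s hs).2).2
      have hPgood : ∀ s ∈ Metric.ball p η, s ∈ P →
          (h s - h p) * (s - p) ≤ (-(Z p) ^ 2 + ε) * (s - p) ^ 2 := by
        intro s hs hsP
        exact (hηs s hs).1.2 (hJn s (hηs s hs).2 hsP)
      refine Metric.eventually_nhds_iff_ball.2 ⟨η, hη, ?_⟩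
      intro s hs
      have hsb := hs
      rw [Metric.mem_ball, Real.dist_eq, abs_lt] at hsb
      have hbt : ∀ y, min p s ≤ y → y ≤ max p s → y ∈ Metric.ball p η := by
        intro y h1 h2
        rw [Metric.mem_ball, Real.dist_eq, abs_lt]
        rcases le_total p s with h3 | h3
        · rw [min_eq_left h3] at h1; rw [max_eq_right h3] at h2
          constructor <;> linarith
        · rw [min_eq_right h3] at h1; rw [max_eq_left h3] at h2
          constructor <;> linarith
      by_cases hsP : s ∈ P
      · exact hPgood s hs hsP
      have hcl : IsClosed (interior D)ᶜ := isOpen_interior.isClosed_compl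
      rcases le_total p s with h3 | h3
      · rw [min_eq_left h3, max_eq_right h3] at hbt
        obtain ⟨α, ⟨⟨hα1, hα2⟩, hα3⟩, hα4⟩ :=
          ((isCompact_Icc (a := p) (b := s)).inter_right hcl).exists_isGreatest
            ⟨p, ⟨le_rfl, h3⟩, hpP.2⟩
        have hαb := hbt α hα1 hα2
        have hαP : α ∈ P := ⟨hInt α hαb, hα3⟩
        have hαs : α < s := lt_of_le_of_ne hα2 (fun hh => hsP (hh ▸ hαP))
        obtain ⟨M, hM⟩ := hA α (hInt α hαb)
        have k1 := jf_endR h Z α s κ M hαs hZ (fun y hy => by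
            have : y ∈ interior D := by
              by_contra hcon
              have := hα4 ⟨⟨by linarith [hy.1], hy.2⟩, hcon⟩
              linarith [hy.1]
            exact interior_subset this)
          (fun y hy => (hηs y (hbt y (by linarith [hy.1]) hy.2)).1.1.le) hM
        have k2 := hPgood α hαb hαP
        have k3 : h α + κ * α ≤ h p + κ * p := by
          rcases hα1.lt_or_eq with h4 | h4
          · have : 0 < α - p := by linarith
            nlinarith
          · rw [h4]
        nlinarith
      · rw [min_eq_right h3, max_eq_left h3] at hbt
        obtain ⟨β, ⟨⟨hα1, hα2⟩, hα3⟩, hα4⟩ :=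
          ((isCompact_Icc (a := s) (b := p)).inter_right hcl).exists_isLeast
            ⟨p, ⟨h3, le_rfl⟩, hpP.2⟩
        have hαb := hbt β hα1 hα2
        have hαP : β ∈ P := ⟨hInt β hαb, hα3⟩
        have hαs : s < β := lt_of_le_of_ne hα1 (fun hh => hsP (hh ▸ hαP))
        obtain ⟨M, hM⟩ := hA β (hInt β hαb)
        have k1 := jf_endL h Z β s κ M hαs hZ (fun y hy => by
            have : y ∈ interior D := by
              by_contra hcon
              have := hα4 ⟨⟨hy.1, by linarith [hy.2]⟩, hcon⟩
              linarith [hy.2]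
            exact interior_subset this)
          (fun y hy => (hηs y (hbt y hy.1 (by linarith [hy.2]))).1.1.le) hM
        have k2 := hPgood β hαb hαP
        have k3 : h p + κ * p ≤ h β + κ * β := by
          rcases hα2.lt_or_eq with h4 | h4
          · have : 0 < p - β := by linarith
            nlinarith
          · rw [h4]
        nlinarith
    exact x.2.2 (mem_interior.2 ⟨_, hJD, Metric.isOpen_ball, Metric.mem_ball_self hρ⟩)
  intro a ha b hb hab
  have := jf_antiD h (fun p => Z p ^ 2) a b 0 hab
    (fun p hp => main ⟨by linarith [ha.1, hp.1], by linarith [hb.2, hp.2]⟩)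
    (fun p hp => sq_nonneg _)
  simpa using this

lemma jf_vec {E : Type*} [NormedAddCommGroup E] [InnerProductSpace ℝ E]
    (h : ℝ → ℝ) (z : ℝ → E) (l r : ℝ)
    (H1 : ∀ p ∈ Ioo l r, ∃ (Y : ℝ → E) (c : ℝ → ℝ) (c' : ℝ), HasDerivAt Y (-z p) p ∧ Y p = 0 ∧
      HasDerivAt c c' p ∧ c p = 0 ∧ c' ≤ 0 ∧ ∀ s ∈ Ioo l r, h s - h p = ⟪z s, Y s⟫ + c s)
    (H2 : ∀ p ∈ Ioo l r, ∃ (V : ℝ → E) (e : ℝ → ℝ), ContinuousAt V p ∧ V p = 0 ∧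
      ContinuousAt e p ∧ e p = ‖z p‖ ^ 2 ∧ ∀ s ∈ Ioo l r, ⟪z s, z p⟫ = ⟪z s, V s⟫ + e s) :
    AntitoneOn h (Ioo l r) := by
  apply jf_scalar h (fun s => ‖z s‖) l r (fun _ => norm_nonneg _)
  · intro p hp
    obtain ⟨Y, c, c', hY, hY0, hc, hc0, hc', hh⟩ := H1 p hp
    obtain ⟨M1, h1⟩ := hY.isBigO_sub.bound
    obtain ⟨M2, h2⟩ := hc.isBigO_sub.bound
    refine ⟨|M1| + |M2|, ?_⟩
    filter_upwards [h1, h2, isOpen_Ioo.mem_nhds hp] with s h1 h2 hs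
    rw [hh s hs]
    rw [hY0, sub_zero, Real.norm_eq_abs] at h1
    rw [hc0, sub_zero, Real.norm_eq_abs, Real.norm_eq_abs] at h2
    have i1 : |⟪z s, Y s⟫| ≤ ‖z s‖ * (|M1| * |s - p|) := by
      refine (abs_real_inner_le_norm _ _).trans ?_
      gcongr
      exact h1.trans (by gcongr; exact le_abs_self _)
    have i2 : |c s| ≤ |M2| * |s - p| := h2.trans (by gcongr; exact le_abs_self _)
    have i3 : 0 ≤ ‖z s‖ * (|M2| * |s - p|) := by positivity
    have i4 : 0 ≤ |M1| * |s - p| := by positivity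
    have := abs_add_le ⟪z s, Y s⟫ (c s)
    linarith
  · intro p hp y hy
    obtain ⟨V, e, hV, hV0, he, he0, hh⟩ := H2 p hp
    rcases lt_or_ge y 0 with hy0 | hy0
    · exact Eventually.of_forall fun s => lt_of_lt_of_le hy0 (sq_nonneg _)
    have hlt : √y < ‖z p‖ := by
      rw [Real.sqrt_lt' ]
      · exact hy
      · by_contra hcon
        have : ‖z p‖ = 0 := le_antisymm (not_lt.1 hcon) (norm_nonneg _)
        simp only [this] at hy
        norm_num at hy
        linarith
    have hpos : 0 < ‖z p‖ := lt_of_le_of_lt (Real.sqrt_nonneg _) hlt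
    have hcont : ContinuousAt (fun s => e s - √y * (‖z p‖ + ‖V s‖)) p := by fun_prop
    have hev := hcont.eventually_const_lt (u := 0) (by simp only [hV0, he0, norm_zero]; nlinarith)
    filter_upwards [hev, isOpen_Ioo.mem_nhds hp] with s hs1 hs
    have h1 := hh s hs
    have i1 := real_inner_le_norm (z s) (z p)
    have i2 := (abs_le.1 (abs_real_inner_le_norm (z s) (V s))).1
    have i3 : √y < ‖z s‖ := by
      by_contra hcon
      push Not at hcon
      have : ‖z s‖ * (‖z p‖ + ‖V s‖) ≤ √y * (‖z p‖ + ‖V s‖) := by gcongr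
      linarith
    exact (Real.sqrt_lt' (lt_of_le_of_lt (Real.sqrt_nonneg _) i3)).1 i3
  · intro p hp n ε hε
    obtain ⟨Y, c, c', hY, hY0, hc, hc0, hc', hh⟩ := H1 p hp
    obtain ⟨V, e, hV, hV0, he, he0, hh2⟩ := H2 p hp
    set N := √n with hN
    have hN0 : 0 ≤ N := Real.sqrt_nonneg _
    set η := ε / (2 * (N + 1)) with hη
    have hη0 : 0 < η := by positivity
    have hηe : N * η + η = ε / 2 := by rw [hη]; field_simp
    have h1 := (hasDerivAt_iff_isLittleO.1 hY).bound hη0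
    have h2 := (hasDerivAt_iff_isLittleO.1 hc).bound hη0
    have hcont : ContinuousAt (fun s => e s - N * ‖V s‖) p := by fun_prop
    have hev := hcont.eventually_const_lt (u := ‖z p‖ ^ 2 - ε / 2)
      (by simp only [hV0, he0, norm_zero]; linarith)
    filter_upwards [h1, h2, hev, isOpen_Ioo.mem_nhds hp] with s h1 h2 h3 hs hZn
    have hzN : ‖z s‖ ≤ N := Real.le_sqrt_of_sq_le hZn
    rw [hY0, sub_zero, Real.norm_eq_abs] at h1
    rw [hc0, sub_zero, Real.norm_eq_abs, Real.norm_eq_abs, smul_eq_mul] at h2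
    set x := s - p with hx
    have e1 : ⟪z s, Y s⟫ = ⟪z s, Y s - x • -z p⟫ - x * ⟪z s, z p⟫ := by
      simp [inner_add_right, inner_smul_right]
    have i1 : |⟪z s, Y s - x • -z p⟫| ≤ N * (η * |x|) :=
      (abs_real_inner_le_norm _ _).trans (by gcongr)
    have i2 : ‖z p‖ ^ 2 - ε / 2 ≤ ⟪z s, z p⟫ := by
      rw [hh2 s hs]
      have i2 := (abs_le.1 (abs_real_inner_le_norm (z s) (V s))).1
      have : ‖z s‖ * ‖V s‖ ≤ N * ‖V s‖ := by gcongr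
      linarith
    rw [hh s hs, e1]
    have e2 : (⟪z s, Y s - x • -z p⟫ - x * ⟪z s, z p⟫ + c s) * x =
      ⟪z s, Y s - x • -z p⟫ * x + (c s - x * c') * x + c' * x ^ 2 - x ^ 2 * ⟪z s, z p⟫ := by ring
    rw [e2]
    have j1 : ⟪z s, Y s - x • -z p⟫ * x ≤ N * η * x ^ 2 := by
      refine (le_abs_self _).trans ?_
      rw [abs_mul, ← sq_abs x]
      have := mul_le_mul_of_nonneg_right i1 (abs_nonneg x)
      linarith
    have j2 : (c s - x * c') * x ≤ η * x ^ 2 := by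
      refine (le_abs_self _).trans ?_
      rw [abs_mul, ← sq_abs x]
      have := mul_le_mul_of_nonneg_right h2 (abs_nonneg x)
      linarith
    have j3 : c' * x ^ 2 ≤ 0 := mul_nonpos_of_nonpos_of_nonneg hc' (sq_nonneg _)
    have j4 : x ^ 2 * (‖z p‖ ^ 2 - ε / 2) ≤ x ^ 2 * ⟪z s, z p⟫ := by gcongr
    have j5 : N * η * x ^ 2 + η * x ^ 2 = ε / 2 * x ^ 2 := by rw [← hηe]; ring
    nlinarith

section flow
variable {E : Type*} [NormedAddCommGroup E] [InnerProductSpace ℝ E]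

lemma jf_app {S : ℝ → E →L[ℝ] E} {S' : E →L[ℝ] E} {t : ℝ} (h : HasDerivAt S S' t) (u : E) :
    HasDerivAt (fun t => S t u) (S' u) t := by
  simpa using h.clm_apply (hasDerivAt_const t u)

lemma jf_lagr (R : ℝ → E →L[ℝ] E)
    (hRsymm : ∀ t (u v : E), ⟪R t u, v⟫ = ⟪u, R t v⟫)
    (T T' : ℝ → E →L[ℝ] E)
    (hT : ∀ t, HasDerivAt T (T' t) t)
    (hT' : ∀ t, HasDerivAt T' (-((R t).comp (T t))) t)
    (h0 : ∀ x y, ⟪T' 0 x, T 0 y⟫ = ⟪T 0 x, T' 0 y⟫) (s : ℝ) (x y : E) :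
    ⟪T' s x, T s y⟫ = ⟪T s x, T' s y⟫ := by
  have hTu : ∀ t u, HasDerivAt (fun t => T t u) (T' t u) t := fun t u => jf_app (hT t) u
  have hTu' : ∀ t u, HasDerivAt (fun t => T' t u) (-(R t (T t u))) t := fun t u => by
    simpa using jf_app (hT' t) u
  have hd : ∀ t, HasDerivAt (fun t => ⟪T' t x, T t y⟫ - ⟪T t x, T' t y⟫) 0 t := by
    intro t
    have := ((hTu' t x).inner ℝ (hTu t y)).sub ((hTu t x).inner ℝ (hTu' t y))
    refine this.congr_deriv ?_
    simp only [inner_neg_left, inner_neg_right, hRsymm]; ring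
  have := is_const_of_deriv_eq_zero (fun t => (hd t).differentiableAt) (fun t => (hd t).deriv) s 0
  simp only [h0, sub_self] at this
  linarith

lemma jf_anti (R : ℝ → E →L[ℝ] E)
    (δ : ℝ → ℝ)
    (hbound : ∀ s (u : E), δ s * ‖u‖ ^ 2 ≤ ⟪R s u, u⟫)
    (T T' : ℝ → E →L[ℝ] E)
    (hT : ∀ t, HasDerivAt T (T' t) t)
    (hT' : ∀ t, HasDerivAt T' (-((R t).comp (T t))) t)
    (f f' : ℝ → ℝ)
    (hf : ∀ s, HasDerivAt f (f' s) s)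
    (hf' : ∀ s, HasDerivAt f' (-(δ s * f s)) s)
    (hL : ∀ s x y, ⟪T' s x, T s y⟫ = ⟪T s x, T' s y⟫)
    (s₁ : ℝ)
    (hsurj : ∀ s ∈ Ioo (0 : ℝ) s₁, Function.Surjective (T s)) (v : E) (a : ℝ → E)
    (ha : ∀ s ∈ Ioo (0 : ℝ) s₁, T s (a s) = v) :
    AntitoneOn (fun s => f s * ⟪f s • T' s (a s) - f' s • v, v⟫) (Ioo 0 s₁) := by
  have hTu : ∀ t u, HasDerivAt (fun t => T t u) (T' t u) t := fun t u => jf_app (hT t) u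
  have hTu' : ∀ t u, HasDerivAt (fun t => T' t u) (-(R t (T t u))) t := fun t u => by
    simpa using jf_app (hT' t) u
  set z : ℝ → E := fun s => f s • T' s (a s) - f' s • v with hz
  -- two-point identity
  have two : ∀ p s, s ∈ Ioo 0 s₁ → ∀ b : E, f s * ⟪T' s (a s), T p b⟫ =
      ⟪z s + f' s • v, T p b - T s b⟫ + f s * ⟪v, T' s b⟫ := by
    intro p s hs b
    have e1 := hL s (a s) b
    rw [ha s hs] at e1
    simp only [hz, sub_add_cancel, inner_sub_right, real_inner_smul_left]
    rw [e1]; ring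
  apply jf_vec _ z
  · intro p hp
    have hap := ha p hp
    refine ⟨fun s => f p • (T p (a p) - T s (a p)) + (f s - f p) • v,
      fun s => f' s * ⟪v, f p • (T p (a p) - T s (a p))⟫
        + f p * f s * ⟪v, T' s (a p) - T' p (a p)⟫
        + (f s - f p) * (f' s * ‖v‖ ^ 2 + ⟪z p, v⟫ + f' p * ‖v‖ ^ 2)
        - ‖v‖ ^ 2 * (f s * f' s - f p * f' p),
      - f p ^ 2 * (⟪R p v, v⟫ - δ p * ‖v‖ ^ 2), ?_, ?_, ?_, ?_, ?_, ?_⟩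
    · have h1 := ((hTu p (a p)).const_sub (T p (a p))).const_smul (f p)
      have h2 := ((hf p).sub_const (f p)).smul_const v
      refine (h1.add h2).congr_deriv ?_
      simp only [hz, smul_neg]; abel
    · simp
    · have g1 : HasDerivAt (fun s => ⟪v, f p • (T p (a p) - T s (a p))⟫)
          (⟪v, f p • -T' p (a p)⟫) p := by
        have := (hasDerivAt_const p v).inner ℝ
          (((hTu p (a p)).const_sub (T p (a p))).const_smul (f p))
        simpa using this
      have g2 : HasDerivAt (fun s => ⟪v, T' s (a p) - T' p (a p)⟫) (⟪v, -(R p v)⟫) p := by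
        have := (hasDerivAt_const p v).inner ℝ ((hTu' p (a p)).sub_const (T' p (a p)))
        rw [hap] at this
        simpa using this
      have g3 := (hf' p).mul g1
      have g4 := ((hf p).const_mul (f p)).mul g2
      have g5 := ((hf p).sub_const (f p)).mul
        ((((hf' p).mul_const (‖v‖ ^ 2)).add_const ⟪z p, v⟫).add_const (f' p * ‖v‖ ^ 2))
      have g6 := (((hf p).mul (hf' p)).sub_const (f p * f' p)).const_mul (‖v‖ ^ 2)
      refine (((g3.add g4).add g5).sub g6).congr_deriv ?_
      simp only [hz, sub_self, inner_sub_left, real_inner_smul_left, inner_smul_right, inner_neg_right,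
        smul_zero, inner_zero_right, real_inner_self_eq_norm_sq]
      rw [real_inner_comm v (R p v), real_inner_comm v (T' p (a p))]
      ring
    · simp
    · have := hbound p v
      nlinarith [sq_nonneg (f p)]
    · intro s hs
      have e := two p s hs (a p)
      rw [hap] at e
      have ep := hL p (a p) (a p)
      rw [hap] at ep
      simp only [inner_add_left, inner_sub_left, real_inner_smul_left, inner_smul_right, inner_sub_right,
        inner_add_right, real_inner_self_eq_norm_sq, hz, hap] at e ep ⊢
      rw [real_inner_comm v (T' p (a p))] at *
      linear_combination (f p) * e
  · intro p hp
    obtain ⟨b, hb⟩ := hsurj p hp (z p)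
    have hap := ha p hp
    refine ⟨fun s => T p b - T s b, fun s => f' s * ⟪v, T p b - T s b⟫ + f s * ⟪v, T' s b⟫
      - f' s * ⟪v, z p⟫, ?_, ?_, ?_, ?_, ?_⟩
    · exact ((hTu p b).const_sub _).continuousAt
    · simp
    · have c1 := (hTu p b).continuousAt
      have c2 := (hTu' p b).continuousAt
      have c3 := (hf p).continuousAt
      have c4 := (hf' p).continuousAt
      fun_prop
    · have e := hL p (a p) b
      rw [hap, hb] at e
      simp only [sub_self, inner_zero_right, mul_zero, zero_add]
      rw [← e, ← real_inner_self_eq_norm_sq]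
      conv_rhs => rw [hz]
      simp only [inner_sub_left, real_inner_smul_left]
      rfl
    · intro s hs
      have e := two p s hs b
      rw [hb] at e
      rw [hb]
      have : ⟪z s, z p⟫ = f s * ⟪T' s (a s), z p⟫ - f' s * ⟪v, z p⟫ := by
        conv_lhs => rw [hz]
        simp only [inner_sub_left, real_inner_smul_left]
        rfl
      rw [this, e, inner_add_left, real_inner_smul_left]
      ring

end flow

section flow2
variable {E : Type*} [NormedAddCommGroup E] [InnerProductSpace ℝ E]

lemma jf_init (T T' : ℝ → E →L[ℝ] E)
    (hT : ∀ t, HasDerivAt T (T' t) t)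
    (f f' : ℝ → ℝ)
    (hf : ∀ s, HasDerivAt f (f' s) s)
    (hinit : (T 0 = 0 ∧ T' 0 = ContinuousLinearMap.id ℝ E ∧ f 0 = 0 ∧ f' 0 = 1) ∨
      (T 0 = ContinuousLinearMap.id ℝ E ∧ T' 0 = 0 ∧ f 0 = 1 ∧ f' 0 = 0)) :
    (∃ K, 0 ≤ K ∧ ∀ᶠ s in 𝓝[>] (0:ℝ), ∀ x, |f s| * ‖x‖ ≤ K * ‖T s x‖) ∧
      ∀ᶠ s in 𝓝[>] (0:ℝ), 0 < f s := by
  rcases hinit with ⟨h1, h2, h3, h4⟩ | ⟨h1, h2, h3, h4⟩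
  · have e1 := (hasDerivAt_iff_isLittleO.1 (hT 0)).bound (c := 1/2) (by norm_num)
    have e2 := (hasDerivAt_iff_isLittleO.1 (hf 0)).bound (c := 1/2) (by norm_num)
    simp only [h1, h2, h3, h4, sub_zero, smul_eq_mul, mul_one] at e1 e2
    refine ⟨⟨4, by norm_num, ?_⟩, ?_⟩
    · filter_upwards [nhdsWithin_le_nhds e1, nhdsWithin_le_nhds e2, self_mem_nhdsWithin]
        with s k1 k2 hs x
      have hs : 0 < s := hs
      rw [Real.norm_eq_abs, abs_of_pos hs] at k1
      rw [Real.norm_eq_abs, Real.norm_eq_abs, abs_of_pos hs] at k2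
      have k3 : |f s| ≤ 2 * s := by
        rw [abs_le] at k2 ⊢; constructor <;> linarith [k2.1, k2.2]
      have k4 : ‖T s x - s • x‖ ≤ 1 / 2 * s * ‖x‖ := by
        have := (T s - s • ContinuousLinearMap.id ℝ E).le_of_opNorm_le k1 x
        simpa using this
      have k5 : ‖s • x‖ ≤ ‖T s x‖ + ‖T s x - s • x‖ := by
        have := norm_sub_le (T s x) (T s x - s • x)
        simpa using this
      rw [norm_smul, Real.norm_eq_abs, abs_of_pos hs] at k5
      have := mul_le_mul_of_nonneg_right k3 (norm_nonneg x)
      linarith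
    · filter_upwards [nhdsWithin_le_nhds e2, self_mem_nhdsWithin] with s k2 hs
      have hs : 0 < s := hs
      rw [Real.norm_eq_abs, Real.norm_eq_abs, abs_of_pos hs, abs_le] at k2
      linarith [k2.1]
  · have c1 : ContinuousAt (fun s => ‖T s - ContinuousLinearMap.id ℝ E‖) 0 :=
      ((hT 0).continuousAt.sub continuousAt_const).norm
    have e1 := c1.eventually_lt_const (u := 1/2) (by simp [h1])
    have e2 := (hf 0).continuousAt.eventually_lt_const (u := 2) (by rw [h3]; norm_num)
    have e3 := (hf 0).continuousAt.eventually_const_lt (u := 0) (by rw [h3]; norm_num)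
    refine ⟨⟨4, by norm_num, ?_⟩, nhdsWithin_le_nhds e3⟩
    apply nhdsWithin_le_nhds
    filter_upwards [e1, e2, e3] with s k1 k2 k3 x
    have k4 : ‖T s x - x‖ ≤ 1 / 2 * ‖x‖ := by
      have := (T s - ContinuousLinearMap.id ℝ E).le_of_opNorm_le k1.le x
      simpa using this
    have k5 : ‖x‖ ≤ ‖T s x‖ + ‖T s x - x‖ := by
      have := norm_sub_le (T s x) (T s x - x)
      simpa using this
    rw [abs_of_pos k3]
    have := mul_le_mul_of_nonneg_right k2.le (norm_nonneg x)
    linarith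

lemma jf_star (R : ℝ → E →L[ℝ] E)
    (hRsymm : ∀ t (u v : E), ⟪R t u, v⟫ = ⟪u, R t v⟫)
    (δ : ℝ → ℝ)
    (hbound : ∀ s (u : E), δ s * ‖u‖ ^ 2 ≤ ⟪R s u, u⟫)
    (T T' : ℝ → E →L[ℝ] E)
    (hT : ∀ t, HasDerivAt T (T' t) t)
    (hT' : ∀ t, HasDerivAt T' (-((R t).comp (T t))) t)
    (f f' : ℝ → ℝ)
    (hf : ∀ s, HasDerivAt f (f' s) s)
    (hf' : ∀ s, HasDerivAt f' (-(δ s * f s)) s)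
    (hinit : (T 0 = 0 ∧ T' 0 = ContinuousLinearMap.id ℝ E ∧ f 0 = 0 ∧ f' 0 = 1) ∨
      (T 0 = ContinuousLinearMap.id ℝ E ∧ T' 0 = 0 ∧ f 0 = 1 ∧ f' 0 = 0))
    (s₁ : ℝ)
    (hinv : ∀ s ∈ Set.Ioc (0 : ℝ) s₁, Function.Bijective (T s))
    (t : ℝ) (ht : t ∈ Ioo 0 s₁) (u : E) :
    f t * (f t * ⟪T' t u, T t u⟫ - f' t * ‖T t u‖ ^ 2) ≤ 0 := by
  have hinv' : ∀ s ∈ Ioo (0 : ℝ) s₁, Function.Bijective (T s) := fun s hs => hinv s ⟨hs.1, hs.2.le⟩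
  have hL := jf_lagr R hRsymm T T' hT hT' (by
    rcases hinit with ⟨h1, h2, h3, h4⟩ | ⟨h1, h2, h3, h4⟩ <;> simp [h1, h2])
  set v := T t u with hv
  have hex : ∀ s, ∃ x, s ∈ Ioo (0 : ℝ) s₁ → T s x = v := by
    intro s
    by_cases hs : s ∈ Ioo (0 : ℝ) s₁
    · obtain ⟨x, hx⟩ := (hinv' s hs).2 v
      exact ⟨x, fun _ => hx⟩
    · exact ⟨0, fun h => absurd h hs⟩
  choose a ha using hex
  have hat : a t = u := (hinv' t ht).1 (ha t ht)
  have hanti := jf_anti R δ hbound T T' hT hT' f f' hf hf' hL s₁ (fun s hs => (hinv' s hs).2) v a ha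
  obtain ⟨⟨K, hK0, hK⟩, -⟩ := jf_init T T' hT f f' hf hinit
  have hbd : ∀ᶠ s in 𝓝[>] (0:ℝ), f t * (f t * ⟪T' t u, v⟫ - f' t * ‖v‖ ^ 2) ≤
      |f s| * ‖T' s‖ * (K * ‖v‖) * ‖v‖ + |f s * f' s| * ‖v‖ ^ 2 := by
    filter_upwards [hK, Ioo_mem_nhdsGT ht.1] with s hs hst
    have hsI : s ∈ Ioo 0 s₁ := ⟨hst.1, hst.2.trans ht.2⟩
    have h1 := hanti hsI ht hst.2.le
    simp only [inner_sub_left, real_inner_smul_left, real_inner_self_eq_norm_sq, hat] at h1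
    refine h1.trans ?_
    have h2 := hs (a s)
    rw [ha s hsI] at h2
    have h3 : |⟪T' s (a s), v⟫| ≤ ‖T' s‖ * ‖a s‖ * ‖v‖ :=
      (abs_real_inner_le_norm _ _).trans (by gcongr; exact (T' s).le_opNorm _)
    have h4 : f s * (f s * ⟪T' s (a s), v⟫) ≤ |f s| * ‖T' s‖ * (K * ‖v‖) * ‖v‖ := by
      refine (le_abs_self _).trans ?_
      rw [abs_mul, abs_mul]
      calc |f s| * (|f s| * |⟪T' s (a s), v⟫|) ≤ |f s| * (|f s| * (‖T' s‖ * ‖a s‖ * ‖v‖)) := by gcongr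
        _ = |f s| * ‖T' s‖ * (|f s| * ‖a s‖) * ‖v‖ := by ring
        _ ≤ _ := by gcongr
    have h5 : -(f s * f' s) * ‖v‖ ^ 2 ≤ |f s * f' s| * ‖v‖ ^ 2 := by
      gcongr; exact neg_le_abs _
    linarith
  have hcont : ContinuousAt (fun s => |f s| * ‖T' s‖ * (K * ‖v‖) * ‖v‖ + |f s * f' s| * ‖v‖ ^ 2) 0 := by
    have c1 := (hf 0).continuousAt
    have c2 := (hf' 0).continuousAt
    have c3 := (hT' 0).continuousAt
    fun_prop
  have hlim := ge_of_tendsto (hcont.tendsto.mono_left nhdsWithin_le_nhds) hbd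
  refine hlim.trans (le_of_eq ?_)
  rcases hinit with ⟨h1, h2, h3, h4⟩ | ⟨h1, h2, h3, h4⟩ <;> simp [h2, h3, h4]

lemma jf_quot (T T' : ℝ → E →L[ℝ] E)
    (hT : ∀ t, HasDerivAt T (T' t) t)
    (f f' : ℝ → ℝ)
    (hf : ∀ s, HasDerivAt f (f' s) s) (c : ℝ) (u : E)
    (hpos : ∀ s ∈ Ioo 0 c, 0 < f s)
    (hstar : ∀ t ∈ Ioo 0 c, f t * (f t * ⟪T' t u, T t u⟫ - f' t * ‖T t u‖ ^ 2) ≤ 0)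
    (s t : ℝ) (hs : 0 < s) (hst : s ≤ t) (htc : t < c) : ‖T t u‖ * f s ≤ ‖T s u‖ * f t := by
  have hd : ∀ x ∈ Ioo 0 c, HasDerivAt (fun s => ⟪T s u, T s u⟫ / f s ^ 2)
      (((⟪T x u, T' x u⟫ + ⟪T' x u, T x u⟫) * f x ^ 2 -
        ⟪T x u, T x u⟫ * (2 * f x * f' x)) / (f x ^ 2) ^ 2) x := by
    intro x hx
    have h1 := (jf_app (hT x) u).inner ℝ (jf_app (hT x) u)
    have h2 := (hf x).pow 2
    refine (h1.div h2 (pow_ne_zero 2 (hpos x hx).ne')).congr_deriv ?_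
    simp
  have hanti : AntitoneOn (fun s => ⟪T s u, T s u⟫ / f s ^ 2) (Ioo 0 c) := by
    apply antitoneOn_of_deriv_nonpos (convex_Ioo 0 c)
    · exact fun x hx => (hd x hx).continuousAt.continuousWithinAt
    · rw [interior_Ioo]
      exact fun x hx => (hd x hx).differentiableAt.differentiableWithinAt
    · rw [interior_Ioo]
      intro x hx
      rw [(hd x hx).deriv]
      apply div_nonpos_of_nonpos_of_nonneg _ (by positivity)
      have := hstar x hx
      rw [real_inner_self_eq_norm_sq, real_inner_comm (T' x u)]
      linarith
  have hsI : s ∈ Ioo 0 c := ⟨hs, by linarith⟩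
  have htI : t ∈ Ioo 0 c := ⟨by linarith, htc⟩
  have h1 := hanti hsI htI hst
  have ps := hpos s hsI
  have pt := hpos t htI
  simp only [real_inner_self_eq_norm_sq] at h1
  rw [div_le_div_iff₀ (by positivity) (by positivity), ← mul_pow, ← mul_pow] at h1
  exact le_of_sq_le_sq h1 (by positivity)

end flow2

end jfaux

open scoped Topology


/-- Upper comparison estimates for the Jacobi flow. Let `T` be the Jacobi flow along a
unit-speed geodesic (in the parallel trivialization, with symmetric pulled-back curvature
operator `R`), invertible on `0 < s ≤ s₁`, and suppose the curvature lower bound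
`δ(s) ‖u‖² ≤ ⟨R s u, u⟩` holds. Let `f = f_δ` solve `f'' + δ f = 0` with initial conditions
matching those of `T` (conjugate or focal data). Then `‖T s‖ f_δ(t) ≥ ‖T t‖ f_δ(s)` for
`0 ≤ s ≤ t ≤ s₁`, and `‖T s u‖ ≤ f_δ(s) ‖u‖` for `0 ≤ s ≤ s₁`. -/
theorem jacobiFlow_norm_le_comparison
    {E : Type*} [NormedAddCommGroup E] [InnerProductSpace ℝ E]
    (R : ℝ → E →L[ℝ] E)
    (hRsymm : ∀ t (u v : E), ⟪R t u, v⟫ = ⟪u, R t v⟫)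
    (δ : ℝ → ℝ)
    (hbound : ∀ s (u : E), δ s * ‖u‖ ^ 2 ≤ ⟪R s u, u⟫)
    (T T' : ℝ → E →L[ℝ] E)
    (hT : ∀ t, HasDerivAt T (T' t) t)
    (hT' : ∀ t, HasDerivAt T' (-((R t).comp (T t))) t)
    (f f' : ℝ → ℝ)
    (hf : ∀ s, HasDerivAt f (f' s) s)
    (hf' : ∀ s, HasDerivAt f' (-(δ s * f s)) s)
    (hinit : (T 0 = 0 ∧ T' 0 = ContinuousLinearMap.id ℝ E ∧ f 0 = 0 ∧ f' 0 = 1) ∨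
      (T 0 = ContinuousLinearMap.id ℝ E ∧ T' 0 = 0 ∧ f 0 = 1 ∧ f' 0 = 0))
    (s₁ : ℝ) (hs₁ : 0 < s₁)
    (hinv : ∀ s ∈ Set.Ioc (0 : ℝ) s₁, Function.Bijective (T s)) :
    (∀ s t : ℝ, 0 ≤ s → s ≤ t → t ≤ s₁ → ‖T t‖ * f s ≤ ‖T s‖ * f t) ∧
      (∀ s ∈ Set.Icc (0 : ℝ) s₁, ∀ u : E, ‖T s u‖ ≤ f s * ‖u‖) := by
  have hstar := jf_star R hRsymm δ hbound T T' hT hT' f f' hf hf' hinit s₁ hinv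
  rcases subsingleton_or_nontrivial E with hE | hE
  · have hz : ∀ s, T s = 0 := fun s => Subsingleton.elim _ _
    refine ⟨fun s t _ _ _ => by simp [hz], fun s _ u => ?_⟩
    rw [Subsingleton.elim u 0]; simp
  have cT : ∀ u, Continuous (fun s => T s u) := fun u =>
    continuous_iff_continuousAt.2 fun s => (jf_app (hT s) u).continuousAt
  have cf : Continuous f := continuous_iff_continuousAt.2 fun s => (hf s).continuousAt
  have hpos : ∀ x ∈ Set.Ioo 0 s₁, 0 < f x := by
    intro x hx
    by_contra hcon
    push Not at hcon
    obtain ⟨-, hev⟩ := jf_init T T' hT f f' hf hinit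
    obtain ⟨ε, hε, hεs⟩ := (mem_nhdsGT_iff_exists_Ioo_subset' hx.1).1 hev
    have hε : 0 < ε := hε
    have hxε : ε ≤ x := by
      by_contra h
      have h3 : 0 < f x := hεs ⟨hx.1, not_le.1 h⟩
      linarith
    obtain ⟨c, ⟨⟨hc1, hc2⟩, hc3⟩, hc4⟩ :=
      ((isCompact_Icc (a := ε) (b := x)).inter_right
        (isClosed_le cf (continuous_const (y := (0:ℝ))))).exists_isLeast ⟨x, ⟨hxε, le_rfl⟩, hcon⟩
    have hc3 : f c ≤ 0 := hc3
    have hposc : ∀ s ∈ Set.Ioo 0 c, 0 < f s := by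
      intro s hs
      rcases lt_or_ge s ε with h | h
      · exact hεs ⟨hs.1, h⟩
      · by_contra hcon
        have := hc4 ⟨⟨h, by linarith [hs.2]⟩, not_lt.1 hcon⟩
        linarith [hs.2]
    obtain ⟨u, hu⟩ := exists_ne (0 : E)
    have hc0 : 0 < c := by linarith
    have hcs : c < s₁ := by linarith [hx.2]
    have hlim : ‖T c u‖ * f (c / 2) ≤ ‖T (c / 2) u‖ * f c := by
      have k1 : Continuous (fun t => ‖T t u‖ * f (c / 2)) := (cT u).norm.mul continuous_const
      have k2 : Continuous (fun t => ‖T (c / 2) u‖ * f t) := continuous_const.mul cf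
      refine le_of_tendsto_of_tendsto (b := 𝓝[<] c) (k1.continuousAt.tendsto.mono_left nhdsWithin_le_nhds)
        (k2.continuousAt.tendsto.mono_left nhdsWithin_le_nhds) ?_
      filter_upwards [Ioo_mem_nhdsLT (show c / 2 < c by linarith)] with t ht
      exact jf_quot T T' hT f f' hf c u hposc
        (fun t ht => hstar t ⟨ht.1, by linarith [ht.2]⟩ u) (c / 2) t (by linarith) ht.1.le ht.2
    have p2 := hposc (c / 2) ⟨by linarith, by linarith⟩
    have h0 : ‖T (c / 2) u‖ * f c ≤ 0 := mul_nonpos_of_nonneg_of_nonpos (norm_nonneg _) hc3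
    have h1 : ‖T c u‖ = 0 := by
      by_contra hne
      have : 0 < ‖T c u‖ := lt_of_le_of_ne (norm_nonneg _) (Ne.symm hne)
      have := mul_pos this p2
      linarith
    have h2 : T c u = T c 0 := by rw [map_zero]; exact norm_eq_zero.1 h1
    exact hu ((hinv c ⟨hc0, hcs.le⟩).1 h2)
  -- convex approximation
  have happ : ∀ x, Filter.Tendsto (fun l : ℝ => (1 - l) * x + l * (s₁ / 2)) (𝓝[>] 0) (𝓝 x) := by
    intro x
    have : ContinuousAt (fun l : ℝ => (1 - l) * x + l * (s₁ / 2)) 0 := by fun_prop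
    have := this.tendsto
    simp only [sub_zero, one_mul, zero_mul, add_zero] at this
    exact this.mono_left nhdsWithin_le_nhds
  have hIn : ∀ x ∈ Set.Icc 0 s₁, ∀ l ∈ Set.Ioo (0:ℝ) 1,
      (1 - l) * x + l * (s₁ / 2) ∈ Set.Ioo 0 s₁ := by
    intro x hx l hl
    have h1 : 0 < l * s₁ := mul_pos hl.1 hs₁
    have h2 : 0 ≤ (1 - l) * x := mul_nonneg (by linarith [hl.2]) hx.1
    have h3 : (1 - l) * x ≤ (1 - l) * s₁ := mul_le_mul_of_nonneg_left hx.2 (by linarith [hl.2])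
    constructor <;> linarith
  have hl01 : Set.Ioo (0:ℝ) 1 ∈ 𝓝[>] (0:ℝ) := Ioo_mem_nhdsGT one_pos
  have hnn : ∀ x ∈ Set.Icc 0 s₁, 0 ≤ f x := by
    intro x hx
    refine ge_of_tendsto ((cf.tendsto x).comp (happ x)) ?_
    filter_upwards [hl01] with l hl
    exact (hpos _ (hIn x hx l hl)).le
  have hall : ∀ (u : E) (s t : ℝ), 0 ≤ s → s ≤ t → t ≤ s₁ → ‖T t u‖ * f s ≤ ‖T s u‖ * f t := by
    intro u s t hs hst ht
    have hN : ∀ x, Filter.Tendsto (fun l : ℝ => ‖T ((1 - l) * x + l * (s₁ / 2)) u‖) (𝓝[>] 0) (𝓝 ‖T x u‖) :=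
      fun x => ((cT u).norm.tendsto x).comp (happ x)
    have hF : ∀ x, Filter.Tendsto (fun l : ℝ => f ((1 - l) * x + l * (s₁ / 2))) (𝓝[>] 0) (𝓝 (f x)) :=
      fun x => (cf.tendsto x).comp (happ x)
    refine le_of_tendsto_of_tendsto ((hN t).mul (hF s)) ((hN s).mul (hF t)) ?_
    filter_upwards [hl01] with l hl
    have i1 := hIn s ⟨hs, hst.trans ht⟩ l hl
    have i2 := hIn t ⟨hs.trans hst, ht⟩ l hl
    refine jf_quot T T' hT f f' hf s₁ u hpos (fun t ht => hstar t ht u) _ _ i1.1 ?_ i2.2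
    have := mul_le_mul_of_nonneg_left hst (show 0 ≤ 1 - l by linarith [hl.2])
    linarith
  refine ⟨?_, ?_⟩
  · intro s t hs hst ht
    have fs := hnn s ⟨hs, hst.trans ht⟩
    have ft := hnn t ⟨hs.trans hst, ht⟩
    rcases fs.lt_or_eq with h | h
    · rw [← le_div_iff₀ h]
      refine ContinuousLinearMap.opNorm_le_bound _ (by positivity) fun u => ?_
      rw [div_mul_eq_mul_div, le_div_iff₀ h]
      calc ‖T t u‖ * f s ≤ ‖T s u‖ * f t := hall u s t hs hst ht
        _ ≤ (‖T s‖ * ‖u‖) * f t := by gcongr; exact (T s).le_opNorm u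
        _ = _ := by ring
    · rw [← h, mul_zero]; positivity
  · intro t ht u
    rcases hinit with ⟨h1, h2, h3, h4⟩ | ⟨h1, h2, h3, h4⟩
    · rcases ht.1.lt_or_eq with h0 | h0
      · have l1 := (hasDerivAt_iff_tendsto_slope_zero.1 (hf 0)).mono_left (nhdsGT_le_nhdsNE 0)
        have l2 := ((hasDerivAt_iff_tendsto_slope_zero.1 (jf_app (hT 0) u)).mono_left
          (nhdsGT_le_nhdsNE 0)).norm
        simp only [zero_add, h1, h2, h3, h4, sub_zero, ContinuousLinearMap.zero_apply,
          ContinuousLinearMap.id_apply] at l1 l2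
        have := le_of_tendsto_of_tendsto (l1.const_mul ‖T t u‖) (l2.mul_const (f t)) (by
          filter_upwards [Ioo_mem_nhdsGT h0] with s hs
          have k := hall u s t hs.1.le hs.2.le ht.2
          rw [norm_smul, norm_inv, Real.norm_eq_abs, abs_of_pos hs.1, smul_eq_mul]
          have := mul_le_mul_of_nonneg_left k (inv_nonneg.2 hs.1.le)
          linarith)
        linarith
      · rw [← h0, h1, h3]; simp
    · have := hall u 0 t le_rfl ht.1 ht.2
      rw [h1, h3] at this
      simp only [ContinuousLinearMap.id_apply] at this
      linarith
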